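/- There exists a nonempty compact set Y contained in the topological boundary ∂𝔻̄² of the closed unit bidisk in ℂ² such that the point (0,0) lies in the polynomial hull Ŷ of Y (in particular (0,0) ∉ Y), and the uniform algebra P(Y) has dense invertibles. -/

import Mathlib

open BoundedContinuousFunction Set

noncomputable def pev (q : MvPolynomial (Fin 2) ℂ) (z : ℂ × ℂ) : ℂ :=
  MvPolynomial.eval ![z.1, z.2] q

def bidisk : Set (ℂ × ℂ) := {z : ℂ × ℂ | ‖z.1‖ ≤ 1 ∧ ‖z.2‖ ≤ 1}

def polyHull (Y : Set (ℂ × ℂ)) : Set (ℂ × ℂ) :=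
  {z : ℂ × ℂ | ∀ (q : MvPolynomial (Fin 2) ℂ) (M : ℝ),
    (∀ y ∈ Y, ‖pev q y‖ ≤ M) → ‖pev q z‖ ≤ M}

/-- The subalgebra of `Y →ᵇ ℂ` consisting of restrictions to `Y` of polynomial
functions in the two complex coordinates. -/
noncomputable def polySub (Y : Set (ℂ × ℂ)) : Subalgebra ℂ (Y →ᵇ ℂ) where
  carrier := {f : Y →ᵇ ℂ | ∃ q : MvPolynomial (Fin 2) ℂ, ∀ y : Y, f y = pev q ↑y}
  mul_mem' := by
    rintro f g ⟨q, hq⟩ ⟨r, hr⟩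
    exact ⟨q * r, fun y => by simp [pev, hq y, hr y]⟩
  one_mem' := ⟨1, fun y => by simp [pev]⟩
  add_mem' := by
    rintro f g ⟨q, hq⟩ ⟨r, hr⟩
    exact ⟨q + r, fun y => by simp [pev, hq y, hr y]⟩
  zero_mem' := ⟨0, fun y => by simp [pev]⟩
  algebraMap_mem' := fun c => ⟨MvPolynomial.C c, fun y => by simp [pev]⟩

/-- `P(Y)`: the uniform closure of the polynomial restrictions, as a Banach algebra
(a closed subalgebra of the bounded continuous functions on `Y`). -/
noncomputable def PY (Y : Set (ℂ × ℂ)) : Subalgebra ℂ (Y →ᵇ ℂ) :=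
  (polySub Y).topologicalClosure

open Metric Complex MeasureTheory in
theorem circleIntegral_mul_derivative_div_eval {p : Polynomial ℂ} {g : ℂ → ℂ} {c : ℂ} {ρ : ℝ}
    (hρ : 0 < ρ) (hg : Differentiable ℂ g) (hp : ∀ w ∈ sphere c ρ, p.eval w ≠ 0) :
    (∮ w in C(c, ρ), g w * (p.derivative.eval w / p.eval w)) =
      2 * Real.pi * I *
        (p.roots.map fun r => (closedBall c ρ).indicator g r).sum := by
  have hp0 : p ≠ 0 := by
    rintro rfl
    obtain ⟨w, hw⟩ := NormedSpace.sphere_nonempty (x := c) (r := ρ) |>.2 hρ.le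
    exact hp w hw (by simp)
  have hroots : ∀ r ∈ p.roots, r ∉ sphere c ρ := fun r hr hrs =>
    hp r hrs (Polynomial.isRoot_of_mem_roots hr)
  have hsum : (∮ w in C(c, ρ), g w * (p.derivative.eval w / p.eval w)) =
      ∮ w in C(c, ρ), (p.roots.map fun r => (w - r)⁻¹ * g w).sum := by
    refine circleIntegral.integral_congr hρ.le fun w hw => ?_
    rw [(IsAlgClosed.splits p).eval_derivative_div_eval_of_ne_zero (hp w hw),
      Multiset.sum_map_mul_right, mul_comm]
    simp
  rw [hsum]
  clear hsum
  revert hroots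
  induction p.roots using Multiset.induction_on with
  | empty => intro _; simp [circleIntegral]
  | cons a s ih =>
    intro h
    have hcont : ∀ r ∉ sphere c ρ, ContinuousOn (fun w => (w - r)⁻¹ * g w) (sphere c ρ) := by
      intro r hr
      refine ContinuousOn.mul (ContinuousOn.inv₀ (by fun_prop) fun w hw hwr => hr ?_)
        hg.continuous.continuousOn
      rwa [← sub_eq_zero.1 hwr]
    have hsc : ∀ t : Multiset ℂ, (∀ r ∈ t, r ∉ sphere c ρ) →
        ContinuousOn (fun w => (t.map fun r => (w - r)⁻¹ * g w).sum) (sphere c ρ) := by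
      intro t
      induction t using Multiset.induction_on with
      | empty => intro _; simpa using continuousOn_const
      | cons b t iht =>
        intro ht
        simp only [Multiset.map_cons, Multiset.sum_cons]
        exact (hcont b (ht b (by simp))).add (iht fun r hr => ht r (by simp [hr]))
    have hs : ∀ r ∈ s, r ∉ sphere c ρ := fun r hr => h r (by simp [hr])
    have ha : a ∉ sphere c ρ := h a (by simp)
    simp only [Multiset.map_cons, Multiset.sum_cons]
    rw [circleIntegral.integral_add ((hcont a ha).circleIntegrable hρ.le)
      ((hsc s hs).circleIntegrable hρ.le), ih hs, mul_add]
    congr 1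
    by_cases hab : a ∈ ball c ρ
    · have := hg.differentiableOn.circleIntegral_sub_inv_smul hab
      simp only [smul_eq_mul] at this
      rw [this, Set.indicator_of_mem (ball_subset_closedBall hab)]
    · have hac : a ∉ closedBall c ρ := by
        intro hac
        rw [← ball_union_sphere] at hac
        exact hac.elim hab ha
      rw [Set.indicator_of_notMem hac, mul_zero]
      have hd : DifferentiableOn ℂ (fun w => (w - a)⁻¹ * g w) (closedBall c ρ) := by
        refine DifferentiableOn.mul (DifferentiableOn.inv (by fun_prop) fun w hw hwr => hac ?_)
          hg.differentiableOn
        rwa [← sub_eq_zero.1 hwr]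
      exact circleIntegral_eq_zero_of_differentiable_on_off_countable hρ.le Set.countable_empty
        hd.continuousOn fun z hz => (hd z (ball_subset_closedBall hz.1)).differentiableAt
          (closedBall_mem_nhds_of_mem hz.1)

open Metric Complex MeasureTheory in
theorem norm_circleIntegral_center_le {G : ℂ → ℂ → ℂ} {z₀ w₀ : ℂ} {s ρ A : ℝ} (hs : 0 < s)
    (hρ : 0 < ρ)
    (hG : ContinuousOn (Function.uncurry G) (closedBall z₀ s ×ˢ sphere w₀ ρ))
    (hd : ∀ w ∈ sphere w₀ ρ, DifferentiableOn ℂ (fun z => G z w) (ball z₀ s))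
    (hA : ∀ z ∈ sphere z₀ s, ‖∮ w in C(w₀, ρ), G z w‖ ≤ A) :
    ‖∮ w in C(w₀, ρ), G z₀ w‖ ≤ A := by
  have hmv : ∀ w ∈ sphere w₀ ρ, G z₀ w = Real.circleAverage (fun z => G z w) z₀ s := by
    intro w hw
    symm
    apply DiffContOnCl.circleAverage (f := fun z => G z w)
    rw [abs_of_pos hs]
    refine ⟨hd w hw, ?_⟩
    rw [closure_ball _ hs.ne']
    exact hG.comp (f := fun z => (z, w)) (by fun_prop) fun z hz => ⟨hz, hw⟩
  have hcs : ∀ θ, circleMap w₀ ρ θ ∈ sphere w₀ ρ := circleMap_mem_sphere _ hρ.le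
  have hcz : ∀ θ, circleMap z₀ s θ ∈ sphere z₀ s := circleMap_mem_sphere _ hs.le
  have key : (∮ w in C(w₀, ρ), G z₀ w) =
      Real.circleAverage (fun z => ∮ w in C(w₀, ρ), G z w) z₀ s := by
    simp only [circleIntegral, Real.circleAverage]
    rw [intervalIntegral_intervalIntegral_swap, ← intervalIntegral.integral_smul]
    · refine intervalIntegral.integral_congr fun θ _ => ?_
      rw [hmv _ (hcs θ), Real.circleAverage, intervalIntegral.integral_smul, smul_comm]
    · have hc : Continuous (Function.uncurry fun θ φ =>
          deriv (circleMap w₀ ρ) φ • G (circleMap z₀ s θ) (circleMap w₀ ρ φ)) := by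
        have h1 : Continuous fun x : ℝ × ℝ => G (circleMap z₀ s x.1) (circleMap w₀ ρ x.2) :=
          hG.comp_continuous (f := fun x : ℝ × ℝ => (circleMap z₀ s x.1, circleMap w₀ ρ x.2))
            (by fun_prop) fun x => ⟨sphere_subset_closedBall (hcz _), hcs _⟩
        have h2 : Continuous fun x : ℝ × ℝ => deriv (circleMap w₀ ρ) x.2 := by
          simp only [deriv_circleMap]
          fun_prop
        exact h2.smul h1
      exact (hc.continuousOn.integrableOn_compact
        (isCompact_uIcc.prod isCompact_uIcc)).mono_set
        (Set.prod_mono Set.uIoc_subset_uIcc Set.uIoc_subset_uIcc)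
  rw [key, Real.circleAverage, norm_smul]
  have h := intervalIntegral.norm_integral_le_of_norm_le_const (a := 0) (b := 2 * Real.pi)
    (f := fun θ => ∮ w in C(w₀, ρ), G (circleMap z₀ s θ) w) (C := A) fun θ _ => hA _ (hcz θ)
  rw [sub_zero, abs_of_pos Real.two_pi_pos] at h
  rw [norm_inv, Real.norm_of_nonneg Real.two_pi_pos.le, inv_mul_le_iff₀ Real.two_pi_pos]
  linarith

/-- The one-variable polynomial `w ↦ q (z, w)`. -/
noncomputable def slice (q : MvPolynomial (Fin 2) ℂ) (z : ℂ) : Polynomial ℂ :=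
  MvPolynomial.aeval ![Polynomial.C z, Polynomial.X] q

theorem eval_slice (q : MvPolynomial (Fin 2) ℂ) (z w : ℂ) :
    (slice q z).eval w = pev q (z, w) := by
  induction q using MvPolynomial.induction_on with
  | C a => simp [slice, pev]
  | add p q hp hq => simp_all [slice, pev]
  | mul_X p i hp => fin_cases i <;> simp_all [slice, pev]

theorem derivative_slice (q : MvPolynomial (Fin 2) ℂ) (z : ℂ) :
    (slice q z).derivative = slice (MvPolynomial.pderiv 1 q) z := by
  induction q using MvPolynomial.induction_on with
  | C a => simp [slice]
  | add p q hp hq => simp_all [slice]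
  | mul_X p i hp =>
    fin_cases i <;> simp_all [slice, MvPolynomial.pderiv_X, mul_comm]

theorem natDegree_slice_le (q : MvPolynomial (Fin 2) ℂ) (z : ℂ) :
    (slice q z).natDegree ≤ q.totalDegree := by
  have := MvPolynomial.aeval_natDegree_le (n := 1) q le_rfl ![Polynomial.C z, Polynomial.X]
    (by intro i; fin_cases i <;> simp)
  simpa [slice] using this

theorem continuous_pev (q : MvPolynomial (Fin 2) ℂ) : Continuous (pev q) := by
  refine (MvPolynomial.continuous_eval q).comp ?_
  refine continuous_pi fun i => ?_
  fin_cases i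
  · exact continuous_fst
  · exact continuous_snd

theorem differentiable_pev_right (q : MvPolynomial (Fin 2) ℂ) (z : ℂ) :
    Differentiable ℂ fun w => pev q (z, w) := by
  simp only [← eval_slice]
  exact Polynomial.differentiable _

theorem differentiable_pev_left (q : MvPolynomial (Fin 2) ℂ) (w : ℂ) :
    Differentiable ℂ fun z => pev q (z, w) := by
  induction q using MvPolynomial.induction_on with
  | C a => simp [pev]
  | add p q hp hq => simp only [pev, map_add] at *; exact hp.add hq
  | mul_X p i hp =>
    simp only [pev, map_mul] at *
    refine hp.mul ?_
    fin_cases i <;> simp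

open Metric Complex in
theorem exists_zero_near_norm_le {q P : MvPolynomial (Fin 2) ℂ} {z₀ w₀ : ℂ} {ε : ℝ} (hε : 0 < ε)
    (hq : pev q (z₀, w₀) = 0) (hslice : slice q z₀ ≠ 0) (hP : pev P (z₀, w₀) ≠ 0) :
    ∃ z w, z ≠ z₀ ∧ ‖z - z₀‖ < ε ∧ ‖w - w₀‖ < ε ∧ pev q (z, w) = 0 ∧
      ‖pev P (z₀, w₀)‖ ≤ ‖pev P (z, w)‖ := by
  by_contra! hcon
  -- a small circle around `w₀` enclosing no other zero of the slice at `z₀`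
  obtain ⟨ρ, hρ, hρε, hρq⟩ : ∃ ρ > 0, ρ < ε ∧
      ∀ w ∈ closedBall w₀ ρ, pev q (z₀, w) = 0 → w = w₀ := by
    have hfin : ((slice q z₀).roots.toFinset.erase w₀ : Set ℂ).Finite := Finset.finite_toSet _
    have hnhds : ((slice q z₀).roots.toFinset.erase w₀ : Set ℂ)ᶜ ∈ nhds w₀ :=
      hfin.isClosed.isOpen_compl.mem_nhds (by simp)
    obtain ⟨r, hr, hrs⟩ := Metric.mem_nhds_iff.1 hnhds
    refine ⟨min (r / 2) (ε / 2), by positivity, by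
      have := min_le_right (r / 2) (ε / 2); linarith, fun w hw hqw => ?_⟩
    by_contra hne
    have hw' : w ∈ ball w₀ r := by
      have := min_le_left (r / 2) (ε / 2)
      rw [mem_closedBall] at hw
      rw [mem_ball]; linarith
    refine hrs hw' ?_
    simp [hne, hslice, eval_slice, hqw]
  have hsph : ∀ w ∈ sphere w₀ ρ, pev q (z₀, w) ≠ 0 := fun w hw h0 => by
    have := hρq w (sphere_subset_closedBall hw) h0
    rw [this] at hw
    simp at hw
    exact hρ.ne hw
  obtain ⟨s, hs, hsε, hsq⟩ : ∃ s > 0, s < ε ∧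
      ∀ z ∈ closedBall z₀ s, ∀ w ∈ sphere w₀ ρ, pev q (z, w) ≠ 0 := by
    obtain ⟨u, v, hu, hv, hzu, hsv, huv⟩ := generalized_tube_lemma (isCompact_singleton (x := z₀))
      (isCompact_sphere w₀ ρ) (n := {x | pev q x ≠ 0})
      (isOpen_ne_fun (continuous_pev q) continuous_const) (by
        rintro ⟨z, w⟩ ⟨rfl, hw⟩
        exact hsph w hw)
    obtain ⟨r, hr, hrs⟩ := Metric.mem_nhds_iff.1 (hu.mem_nhds (hzu rfl))
    refine ⟨min (r / 2) (ε / 2), by positivity, by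
      have := min_le_right (r / 2) (ε / 2); linarith, fun z hz w hw => ?_⟩
    refine huv (a := (z, w)) ⟨hrs ?_, hsv hw⟩
    have := min_le_left (r / 2) (ε / 2)
    rw [mem_closedBall] at hz
    rw [mem_ball]; linarith
  set M := ‖pev P (z₀, w₀)‖ with hM
  have hMpos : 0 < M := norm_pos_iff.2 hP
  obtain ⟨r, hr0, hrM, hr⟩ : ∃ r, 0 ≤ r ∧ r < M ∧ ∀ z ∈ sphere z₀ s, ∀ w ∈ closedBall w₀ ρ,
      pev q (z, w) = 0 → ‖pev P (z, w)‖ ≤ r := by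
    have hK : IsCompact ((sphere z₀ s ×ˢ closedBall w₀ ρ) ∩ {x | pev q x = 0}) :=
      ((isCompact_sphere _ _).prod (isCompact_closedBall _ _)).inter_right
        (isClosed_eq (continuous_pev q) continuous_const)
    rcases Set.eq_empty_or_nonempty ((sphere z₀ s ×ˢ closedBall w₀ ρ) ∩ {x | pev q x = 0})
      with he | hne
    · refine ⟨0, le_rfl, hMpos, fun z hz w hw h0 => ?_⟩
      exact absurd ⟨(z, w), ⟨⟨hz, hw⟩, h0⟩⟩ (Set.not_nonempty_iff_eq_empty.2 he)
    · obtain ⟨⟨z, w⟩, ⟨⟨hz, hw⟩, h0⟩, hmax⟩ :=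
        hK.exists_isMaxOn hne (continuous_pev P).norm.continuousOn
      refine ⟨‖pev P (z, w)‖, norm_nonneg _, hcon z w ?_ ?_ ?_ h0, fun z' hz' w' hw' h0' =>
        hmax (a := (z', w')) ⟨⟨hz', hw'⟩, h0'⟩⟩
      · rintro rfl
        simp at hz
        exact hs.ne hz
      · rw [← dist_eq_norm]; exact (mem_sphere.1 hz).trans_lt hsε
      · rw [← dist_eq_norm]; exact (mem_closedBall.1 hw).trans_lt hρε
  have hbound : ∀ m : ℕ, M ^ m ≤ q.totalDegree * r ^ m := by
    intro m
    set G : ℂ → ℂ → ℂ := fun z w =>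
      pev P (z, w) ^ m * (pev (MvPolynomial.pderiv 1 q) (z, w) / pev q (z, w)) with hGdef
    have hG : ∀ z ∈ closedBall z₀ s, (∮ w in C(w₀, ρ), G z w) = 2 * Real.pi * I *
        ((slice q z).roots.map fun a =>
          (closedBall w₀ ρ).indicator (fun w => pev P (z, w) ^ m) a).sum := by
      intro z hz
      have hdiff : Differentiable ℂ fun w => pev P (z, w) ^ m :=
        (differentiable_pev_right P z).pow m
      rw [← circleIntegral_mul_derivative_div_eval hρ hdiff fun w hw => by
        rw [eval_slice]; exact hsq z hz w hw]
      simp only [derivative_slice, eval_slice, hGdef]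
    have hnorm : ‖(2 * Real.pi * I : ℂ)‖ = 2 * Real.pi := by
      simp [abs_of_pos Real.pi_pos]
    have hle : ‖∮ w in C(w₀, ρ), G z₀ w‖ ≤ 2 * Real.pi * (q.totalDegree * r ^ m) := by
      refine norm_circleIntegral_center_le hs hρ ?_ ?_ ?_
      · refine ContinuousOn.mul ((continuous_pev P).pow m).continuousOn
          (ContinuousOn.div (continuous_pev _).continuousOn (continuous_pev _).continuousOn ?_)
        rintro ⟨z, w⟩ ⟨hz, hw⟩
        exact hsq z hz w hw
      · intro w hw
        refine DifferentiableOn.mul ((differentiable_pev_left P w).pow m).differentiableOn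
          (DifferentiableOn.div (differentiable_pev_left _ w).differentiableOn
            (differentiable_pev_left _ w).differentiableOn ?_)
        intro z hz
        exact hsq z (ball_subset_closedBall hz) w hw
      · intro z hz
        rw [hG z (sphere_subset_closedBall hz), norm_mul, hnorm]
        gcongr
        have hz0 : slice q z ≠ 0 := by
          intro h0
          obtain ⟨w, hw⟩ := NormedSpace.sphere_nonempty (x := w₀) (r := ρ) |>.2 hρ.le
          refine hsq z (sphere_subset_closedBall hz) w hw ?_
          rw [← eval_slice, h0, Polynomial.eval_zero]
        refine (norm_multiset_sum_le _).trans ?_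
        rw [Multiset.map_map]
        refine (Multiset.sum_le_card_nsmul _ (r ^ m) ?_).trans ?_
        · intro x hx
          obtain ⟨a, ha, rfl⟩ := Multiset.mem_map.1 hx
          simp only [Function.comp_apply]
          by_cases haw : a ∈ closedBall w₀ ρ
          · rw [Set.indicator_of_mem haw, norm_pow]
            gcongr
            refine hr z hz a haw ?_
            rw [← eval_slice]
            exact Polynomial.isRoot_of_mem_roots ha
          · rw [Set.indicator_of_notMem haw, norm_zero]
            positivity
        · rw [Multiset.card_map, nsmul_eq_mul]
          gcongr
          exact (Polynomial.card_roots' _).trans (natDegree_slice_le q z)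
    rw [hG z₀ (mem_closedBall_self hs.le), norm_mul, hnorm] at hle
    have hle' := le_of_mul_le_mul_left hle Real.two_pi_pos
    refine le_trans ?_ hle'
    have hsum : ((slice q z₀).roots.map fun a =>
        (closedBall w₀ ρ).indicator (fun w => pev P (z₀, w) ^ m) a).sum =
        ((slice q z₀).roots.count w₀ : ℂ) * pev P (z₀, w₀) ^ m := by
      rw [Multiset.sum_map_eq_nsmul_single w₀, nsmul_eq_mul,
        Set.indicator_of_mem (mem_closedBall_self hρ.le)]
      intro a ha hmem
      refine Set.indicator_of_notMem (fun haw => ha (hρq a haw ?_)) _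
      rw [← eval_slice]
      exact Polynomial.isRoot_of_mem_roots hmem
    rw [hsum, norm_mul, norm_pow, Complex.norm_natCast]
    have hcount : (1 : ℝ) ≤ (slice q z₀).roots.count w₀ := by
      have : 0 < (slice q z₀).roots.count w₀ := by
        rw [Multiset.count_pos, Polynomial.mem_roots hslice, Polynomial.IsRoot, eval_slice, hq]
      exact_mod_cast this
    exact le_mul_of_one_le_left (by positivity) hcount
  have hlim : Filter.Tendsto (fun m : ℕ => q.totalDegree * (r / M) ^ m) Filter.atTop (nhds 0) := by
    simpa using (tendsto_pow_atTop_nhds_zero_of_lt_one (by positivity)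
      ((div_lt_one hMpos).2 hrM)).const_mul (q.totalDegree : ℝ)
  obtain ⟨m, hm⟩ := (hlim.eventually (gt_mem_nhds one_pos)).exists
  rw [div_pow, ← mul_div_assoc, div_lt_one (by positivity)] at hm
  exact absurd (hbound m) (not_le.2 hm)

theorem bidisk_eq_closedBall : bidisk = Metric.closedBall (0 : ℂ × ℂ) 1 := by
  ext x
  simp [bidisk, Prod.norm_def]

theorem frontier_bidisk : frontier bidisk = Metric.sphere (0 : ℂ × ℂ) 1 := by
  rw [bidisk_eq_closedBall, frontier_closedBall _ one_ne_zero]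

theorem norm_one_add_conj_mul_sq_lt {η : ℝ} (hη : 0 < η) {z a : ℂ} (hz : z ≠ a) :
    ‖1 + (η : ℂ) * (starRingEnd ℂ a) * z‖ ^ 2 < (1 + η * ‖z‖ ^ 2) * (1 + η * ‖a‖ ^ 2) := by
  have h : 0 < ‖z - a‖ ^ 2 := by
    have := norm_pos_iff.2 (sub_ne_zero.2 hz)
    positivity
  rw [← Complex.normSq_eq_norm_sq] at *
  simp only [← Complex.normSq_eq_norm_sq, Complex.normSq_apply] at *
  simp at *
  nlinarith [mul_pos hη h]

theorem exists_sphere_zero_norm_le_of_ne_zero {q P : MvPolynomial (Fin 2) ℂ}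
    (hq : pev q 0 = 0) (hP : pev P 0 ≠ 0) :
    ∃ x ∈ Metric.sphere (0 : ℂ × ℂ) 1, pev q x = 0 ∧ ‖pev P 0‖ ≤ ‖pev P x‖ := by
  by_contra! hcon
  set M := ‖pev P 0‖ with hM
  have hMpos : 0 < M := norm_pos_iff.2 hP
  obtain ⟨r, hr0, hrM, hr⟩ : ∃ r, 0 ≤ r ∧ r < M ∧ ∀ x ∈ Metric.sphere (0 : ℂ × ℂ) 1,
      pev q x = 0 → ‖pev P x‖ ≤ r := by
    have hK : IsCompact (Metric.sphere (0 : ℂ × ℂ) 1 ∩ {x | pev q x = 0}) :=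
      (isCompact_sphere _ _).inter_right (isClosed_eq (continuous_pev q) continuous_const)
    rcases Set.eq_empty_or_nonempty (Metric.sphere (0 : ℂ × ℂ) 1 ∩ {x | pev q x = 0})
      with he | hne
    · refine ⟨0, le_rfl, hMpos, fun x hx h0 => ?_⟩
      exact absurd ⟨x, ⟨hx, h0⟩⟩ (Set.not_nonempty_iff_eq_empty.2 he)
    · obtain ⟨x, ⟨hx, h0⟩, hmax⟩ :=
        hK.exists_isMaxOn hne (continuous_pev P).norm.continuousOn
      exact ⟨_, norm_nonneg _, hcon x hx h0, fun y hy hy0 => hmax (a := y) ⟨hy, hy0⟩⟩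
  obtain ⟨η, hη, hηr⟩ : ∃ η > 0, r ^ 2 * (1 + η) < M ^ 2 := by
    have hrM2 : r ^ 2 < M ^ 2 := by gcongr
    refine ⟨(M ^ 2 - r ^ 2) / (r ^ 2 + 1), div_pos (by linarith) (by positivity), ?_⟩
    have : r ^ 2 * ((M ^ 2 - r ^ 2) / (r ^ 2 + 1)) < M ^ 2 - r ^ 2 := by
      rw [mul_div_assoc', div_lt_iff₀ (by positivity)]
      nlinarith
    linarith
  set ψ : ℂ × ℂ → ℝ := fun x => ‖pev P x‖ ^ 2 * (1 + η * ‖x.1‖ ^ 2) with hψ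
  have hψc : Continuous ψ := by
    have := continuous_pev P
    fun_prop
  have hV : IsCompact (Metric.closedBall (0 : ℂ × ℂ) 1 ∩ {x | pev q x = 0}) :=
    (isCompact_closedBall _ _).inter_right (isClosed_eq (continuous_pev q) continuous_const)
  have h0V : (0 : ℂ × ℂ) ∈ Metric.closedBall (0 : ℂ × ℂ) 1 ∩ {x | pev q x = 0} :=
    ⟨by simp, hq⟩
  obtain ⟨⟨z₀, w₀⟩, ⟨hx, hx0⟩, hmax⟩ := hV.exists_isMaxOn ⟨0, h0V⟩ hψc.continuousOn
  have hmax' : ∀ z w, ‖z‖ ≤ 1 → ‖w‖ ≤ 1 → pev q (z, w) = 0 → ψ (z, w) ≤ ψ (z₀, w₀) :=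
    fun z w hz hw h => hmax (a := (z, w)) ⟨by simp [Prod.norm_def, hz, hw], h⟩
  have hge : M ^ 2 ≤ ψ (z₀, w₀) := by
    have := hmax' 0 0 (by simp) (by simp) hq
    have h0 : ψ (0, 0) = M ^ 2 := by
      simp only [hψ, hM, Prod.mk_zero_zero, Prod.fst_zero, norm_zero]
      ring
    rwa [h0] at this
  have hbd : ∀ z w, ‖(z, w)‖ = 1 → pev q (z, w) = 0 → ψ (z, w) < M ^ 2 := by
    intro z w h h0
    refine lt_of_le_of_lt ?_ hηr
    have hz : ‖z‖ ≤ 1 := (norm_fst_le (z, w)).trans h.le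
    have := hr (z, w) (by simpa using h) h0
    simp only [hψ]
    have hz2 : ‖z‖ ^ 2 ≤ 1 := pow_le_one₀ (norm_nonneg z) hz
    gcongr
    exact mul_le_of_le_one_right hη.le hz2
  have hlt : ‖(z₀, w₀)‖ < 1 := by
    refine lt_of_le_of_ne (by simpa using hx) fun h => ?_
    exact (hbd z₀ w₀ h hx0).not_ge hge
  have hP0 : pev P (z₀, w₀) ≠ 0 := by
    intro h
    simp only [hψ, h] at hge
    norm_num at hge
    nlinarith
  have hz1 : ‖z₀‖ < 1 := (norm_fst_le (z₀, w₀)).trans_lt hlt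
  have hw1 : ‖w₀‖ < 1 := (norm_snd_le (z₀, w₀)).trans_lt hlt
  by_cases hs : slice q z₀ = 0
  · obtain ⟨w, hw, hwmax⟩ := Complex.exists_mem_frontier_isMaxOn_norm
      (U := Metric.ball (0 : ℂ) 1) Metric.isBounded_ball ⟨0, by simp⟩
      (differentiable_pev_right P z₀).diffContOnCl
    rw [frontier_ball _ one_ne_zero, mem_sphere_zero_iff_norm] at hw
    have h1 : ‖pev P (z₀, w₀)‖ ≤ ‖pev P (z₀, w)‖ :=
      hwmax (a := w₀) (subset_closure (by simpa using hw1))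
    have h2 : ψ (z₀, w₀) ≤ ψ (z₀, w) := by
      simp only [hψ]
      gcongr
    refine (hbd z₀ w ?_ ?_).not_ge (hge.trans h2)
    · simp [Prod.norm_def, hw, hz1.le]
    · rw [← eval_slice, hs, Polynomial.eval_zero]
  · set L : MvPolynomial (Fin 2) ℂ :=
      P * (1 + MvPolynomial.C ((η : ℂ) * (starRingEnd ℂ z₀)) * MvPolynomial.X 0) with hL
    have hLev : ∀ z w, pev L (z, w) = pev P (z, w) * (1 + (η : ℂ) * (starRingEnd ℂ z₀) * z) := by
      intro z w
      simp [hL, pev]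
    have hself : ‖1 + (η : ℂ) * (starRingEnd ℂ z₀) * z₀‖ = 1 + η * ‖z₀‖ ^ 2 := by
      rw [mul_assoc, Complex.conj_mul']
      have : (1 + (η : ℂ) * (‖z₀‖ : ℂ) ^ 2) = ((1 + η * ‖z₀‖ ^ 2 : ℝ) : ℂ) := by push_cast; rfl
      rw [this, Complex.norm_of_nonneg (by positivity)]
    have hL0 : pev L (z₀, w₀) ≠ 0 := by
      rw [hLev]
      refine mul_ne_zero hP0 (norm_pos_iff.1 ?_)
      rw [hself]
      positivity
    obtain ⟨z, w, hne, hz, hw, h0, hle⟩ := exists_zero_near_norm_le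
      (ε := min (1 - ‖z₀‖) (1 - ‖w₀‖)) (lt_min (by linarith) (by linarith)) hx0 hs hL0
    have hz' : ‖z‖ ≤ 1 := by
      have := norm_le_norm_add_norm_sub' z z₀
      have := hz.trans_le (min_le_left _ _)
      linarith
    have hw' : ‖w‖ ≤ 1 := by
      have := norm_le_norm_add_norm_sub' w w₀
      have := hw.trans_le (min_le_right _ _)
      linarith
    have hm := hmax' z w hz' hw' h0
    rw [hLev, hLev, norm_mul, norm_mul, hself] at hle
    have hsq := pow_le_pow_left₀ (by positivity) hle 2
    rw [mul_pow, mul_pow] at hsq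
    have hlt' := norm_one_add_conj_mul_sq_lt hη hne
    have hPz : 0 < ‖pev P (z, w)‖ ^ 2 := by
      have : pev P (z, w) ≠ 0 := by
        intro h
        rw [h, norm_zero, zero_mul] at hle
        have := norm_pos_iff.2 hP0
        have : 0 < ‖pev P (z₀, w₀)‖ * (1 + η * ‖z₀‖ ^ 2) := by positivity
        linarith
      have := norm_pos_iff.2 this
      positivity
    have h3 := mul_lt_mul_of_pos_left hlt' hPz
    have h4 := mul_le_mul_of_nonneg_right hm (show 0 ≤ 1 + η * ‖z₀‖ ^ 2 by positivity)
    simp only [hψ] at h4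
    nlinarith

/-- Maximum principle for the part of an algebraic curve in the bidisk. -/
theorem exists_sphere_zero_norm_le {q : MvPolynomial (Fin 2) ℂ} (P : MvPolynomial (Fin 2) ℂ)
    (hq : pev q 0 = 0) :
    ∃ x ∈ Metric.sphere (0 : ℂ × ℂ) 1, pev q x = 0 ∧ ‖pev P 0‖ ≤ ‖pev P x‖ := by
  by_cases hP : pev P 0 = 0
  · obtain ⟨x, hx, hx0, -⟩ := exists_sphere_zero_norm_le_of_ne_zero (P := 1) hq (by simp [pev])
    exact ⟨x, hx, hx0, by simp [hP]⟩
  · exact exists_sphere_zero_norm_le_of_ne_zero hq hP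

theorem exists_norm_pev_le (q : MvPolynomial (Fin 2) ℂ) :
    ∃ B : ℝ, 0 < B ∧ ∀ x ∈ bidisk, ‖pev q x‖ ≤ B := by
  rw [bidisk_eq_closedBall]
  obtain ⟨B, hB⟩ := (isCompact_closedBall (0 : ℂ × ℂ) 1).exists_bound_of_continuousOn
    (continuous_pev q).continuousOn
  exact ⟨max B 1, by positivity, fun x hx => (hB x hx).trans (le_max_left _ _)⟩

theorem norm_one_add_mul_sq_le (η : ℝ) {B : ℝ} {a : ℂ} (ha : ‖a‖ ≤ B) :
    ‖1 + (η : ℂ) * a‖ ^ 2 ≤ 1 + 2 * η * a.re + η ^ 2 * B ^ 2 := by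
  have h : ‖a‖ ^ 2 ≤ B ^ 2 := by gcongr
  simp only [← Complex.normSq_eq_norm_sq, Complex.normSq_apply] at *
  simp at *
  nlinarith [mul_le_mul_of_nonneg_left h (sq_nonneg η)]

/-- Multiplying `p` by a suitable polynomial makes it small where `re q < 1 / 2`. -/
theorem exists_mul_re_half_le (p q : MvPolynomial (Fin 2) ℂ) (hp : pev p 0 = 1)
    (hq : pev q 0 = 1) : ∃ r, p ∣ r ∧ pev r 0 = 1 ∧
      ∀ x ∈ bidisk, 1 / 2 ≤ (pev r x).re → 1 / 2 ≤ (pev q x).re := by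
  obtain ⟨B, hB, hqB⟩ := exists_norm_pev_le (q - 1)
  obtain ⟨A, hA, hpA⟩ := exists_norm_pev_le p
  set η : ℝ := 1 / (2 * B ^ 2) with hη
  have hηpos : 0 < η := by positivity
  set δ : ℝ := 1 - η / 2 with hδ
  obtain ⟨m, hm⟩ : ∃ m : ℕ, A * Real.sqrt δ ^ m < 1 / 2 := by
    have h1 : Real.sqrt δ < 1 := by
      rw [Real.sqrt_lt' one_pos]
      linarith
    have hlim := (tendsto_pow_atTop_nhds_zero_of_lt_one (Real.sqrt_nonneg δ) h1).const_mul A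
    rw [mul_zero] at hlim
    exact (hlim.eventually (gt_mem_nhds one_half_pos)).exists
  refine ⟨p * (1 + MvPolynomial.C (η : ℂ) * (q - 1)) ^ m, dvd_mul_right _ _, ?_, ?_⟩
  · have hev : pev (p * (1 + MvPolynomial.C (η : ℂ) * (q - 1)) ^ m) 0 =
        pev p 0 * (1 + (η : ℂ) * (pev q 0 - 1)) ^ m := by
      simp [pev]
    simp [hev, hp, hq]
  · intro x hx hr
    by_contra! hlt
    have hev : pev (p * (1 + MvPolynomial.C (η : ℂ) * (q - 1)) ^ m) x =
        pev p x * (1 + (η : ℂ) * pev (q - 1) x) ^ m := by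
      simp [pev]
    have hre : (pev (q - 1) x).re = (pev q x).re - 1 := by simp [pev]
    have hsq := norm_one_add_mul_sq_le η (hqB x hx)
    have hηB : η ^ 2 * B ^ 2 = η / 2 := by
      rw [hη]
      field_simp
    have hsq' : ‖1 + (η : ℂ) * pev (q - 1) x‖ ^ 2 ≤ δ := by
      rw [hre, hηB] at hsq
      nlinarith
    have hle := Real.le_sqrt_of_sq_le hsq'
    have : ‖pev p x * (1 + (η : ℂ) * pev (q - 1) x) ^ m‖ < 1 / 2 := by
      rw [norm_mul, norm_pow]
      refine lt_of_le_of_lt ?_ hm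
      gcongr
      exact hpA x hx
    rw [hev] at hr
    linarith [Complex.re_le_norm (pev p x * (1 + (η : ℂ) * pev (q - 1) x) ^ m)]

/-- The restriction to `Y` of a polynomial, as an element of `P(Y)`. -/
noncomputable def polyRestrict {Y : Set (ℂ × ℂ)} (hY : Y ⊆ bidisk) (q : MvPolynomial (Fin 2) ℂ) :
    PY Y :=
  ⟨BoundedContinuousFunction.ofNormedAddCommGroup (fun y : Y => pev q y)
      ((continuous_pev q).comp continuous_subtype_val) (exists_norm_pev_le q).choose
      fun y => (exists_norm_pev_le q).choose_spec.2 y (hY y.2),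
    (polySub Y).le_topologicalClosure ⟨q, fun _ => rfl⟩⟩

theorem polyRestrict_apply {Y : Set (ℂ × ℂ)} (hY : Y ⊆ bidisk) (q : MvPolynomial (Fin 2) ℂ)
    (y : Y) : (polyRestrict hY q : Y →ᵇ ℂ) y = pev q y := rfl

theorem polyRestrict_mul {Y : Set (ℂ × ℂ)} (hY : Y ⊆ bidisk) (q r : MvPolynomial (Fin 2) ℂ) :
    polyRestrict hY (q * r) = polyRestrict hY q * polyRestrict hY r := by
  ext y
  simp [polyRestrict_apply, pev]

theorem completeSpace_PY (Y : Set (ℂ × ℂ)) : CompleteSpace (PY Y) :=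
  (polySub Y).isClosed_topologicalClosure.completeSpace_coe

theorem isUnit_polyRestrict_of_re {Y : Set (ℂ × ℂ)} (hY : Y ⊆ bidisk)
    {q : MvPolynomial (Fin 2) ℂ} (hq : ∀ y ∈ Y, 1 / 2 ≤ (pev q y).re) :
    IsUnit (polyRestrict hY q) := by
  have := completeSpace_PY Y
  obtain ⟨B, hB, hqB⟩ := exists_norm_pev_le q
  set η : ℝ := 1 / (2 * B ^ 2) with hη
  have hηpos : 0 < η := by positivity
  have hηB : η ^ 2 * B ^ 2 = η / 2 := by
    rw [hη]
    field_simp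
  have hlt : ‖1 - (η : ℂ) • polyRestrict hY q‖ < 1 := by
    have hle : ‖1 - (η : ℂ) • polyRestrict hY q‖ ≤ Real.sqrt (1 - η / 2) := by
      refine (BoundedContinuousFunction.norm_le (Real.sqrt_nonneg _)).2 fun y => ?_
      refine Real.le_sqrt_of_sq_le ?_
      have h := norm_one_add_mul_sq_le η (a := -pev q y) (by simpa using hqB y (hY y.2))
      have h' := hq y y.2
      have heq : ((1 - (η : ℂ) • polyRestrict hY q : PY Y) : Y →ᵇ ℂ) y =
          1 + (η : ℂ) * -pev q y := by
        simp [polyRestrict_apply, sub_eq_add_neg]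
      change ‖((1 - (η : ℂ) • polyRestrict hY q : PY Y) : Y →ᵇ ℂ) y‖ ^ 2 ≤ _
      rw [heq]
      rw [hηB, Complex.neg_re] at h
      nlinarith
    refine hle.trans_lt ?_
    rw [Real.sqrt_lt' one_pos]
    linarith
  have hu := (Units.oneSub _ hlt).isUnit
  rw [Units.val_oneSub, sub_sub_cancel] at hu
  have hη0 : (η : ℂ) ≠ 0 := by exact_mod_cast hηpos.ne'
  have := hu.smul (Units.mk0 (η : ℂ) hη0)⁻¹
  rwa [← Units.smul_mk0 hη0, inv_smul_smul] at this

/-- A sequence of polynomials taking the value `1` at the origin, whose nonzero multiples are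
uniformly dense on the bidisk among all polynomials. -/
theorem exists_dense_seq : ∃ p : ℕ → MvPolynomial (Fin 2) ℂ, (∀ n, pev (p n) 0 = 1) ∧
    ∀ (Q : MvPolynomial (Fin 2) ℂ) (ε : ℝ), 0 < ε → ∃ n, ∃ a : ℂ, a ≠ 0 ∧
      ∀ x ∈ bidisk, ‖a * pev (p n) x - pev Q x‖ ≤ ε := by
  have hcomp : CompactSpace bidisk := by
    rw [← isCompact_iff_compactSpace, bidisk_eq_closedBall]
    exact isCompact_closedBall _ _
  set T : Set C(bidisk, ℂ) :=
    {f | ∃ p : MvPolynomial (Fin 2) ℂ, pev p 0 = 1 ∧ ∀ x : bidisk, f x = pev p x} with hT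
  obtain ⟨t, htT, htc, hTt⟩ :=
    (TopologicalSpace.IsSeparable.of_separableSpace T).exists_countable_dense_subset
  have hTmem : ∀ p : MvPolynomial (Fin 2) ℂ, pev p 0 = 1 →
      (⟨fun x : bidisk => pev p x, (continuous_pev p).comp continuous_subtype_val⟩ :
        C(bidisk, ℂ)) ∈ T := fun p hp => ⟨p, hp, fun _ => rfl⟩
  have htne : t.Nonempty := closure_nonempty_iff.1 ⟨_, hTt (hTmem 1 (by simp [pev]))⟩
  obtain ⟨u, rfl⟩ := htc.exists_eq_range htne
  choose p hp0 hp using fun n => htT ⟨n, rfl⟩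
  refine ⟨p, hp0, fun Q ε hε => ?_⟩
  obtain ⟨c, hc, hcQ⟩ : ∃ c : ℂ, ‖c‖ ≤ ε / 2 ∧ pev Q 0 + c ≠ 0 := by
    by_cases h : pev Q 0 = 0
    · refine ⟨((ε / 2 : ℝ) : ℂ), by rw [Complex.norm_of_nonneg (by positivity)], ?_⟩
      rw [h, zero_add]
      exact_mod_cast (half_pos hε).ne'
    · exact ⟨0, by simpa using (half_pos hε).le, by simpa using h⟩
  set a := pev Q 0 + c with ha
  have hev : ∀ x, pev (MvPolynomial.C a⁻¹ * (Q + MvPolynomial.C c)) x = a⁻¹ * (pev Q x + c) := by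
    intro x
    simp [pev]
  have hmem := hTt (hTmem (MvPolynomial.C a⁻¹ * (Q + MvPolynomial.C c)) (by
    rw [hev, ← ha, inv_mul_cancel₀ hcQ]))
  have hapos := norm_pos_iff.2 hcQ
  obtain ⟨_, ⟨n, rfl⟩, hn⟩ := Metric.mem_closure_iff.1 hmem (ε / 2 / ‖a‖) (by positivity)
  refine ⟨n, a, hcQ, fun x hx => ?_⟩
  have h1 := (ContinuousMap.dist_apply_le_dist ⟨x, hx⟩).trans hn.le
  simp only [ContinuousMap.coe_mk, hev, hp, dist_eq_norm] at h1
  rw [le_div_iff₀ hapos, ← norm_mul] at h1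
  have heq : a * pev (p n) x - pev Q x =
      c - (a⁻¹ * (pev Q x + c) - pev (p n) x) * a := by
    field_simp
    ring
  rw [heq]
  refine (norm_sub_le _ _).trans ?_
  linarith

/-- Polynomials `q n`, divisible by the given `p n`, whose regions `re (q n) ≥ 1 / 2` in the
bidisk decrease. -/
theorem exists_decreasing_seq (p : ℕ → MvPolynomial (Fin 2) ℂ) (hp : ∀ n, pev (p n) 0 = 1) :
    ∃ q : ℕ → MvPolynomial (Fin 2) ℂ, (∀ n, p n ∣ q n) ∧ (∀ n, pev (q n) 0 = 1) ∧
      ∀ n, ∀ x ∈ bidisk, 1 / 2 ≤ (pev (q (n + 1)) x).re → 1 / 2 ≤ (pev (q n) x).re := by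
  choose f hdvd hf0 hf using fun (n : ℕ) (q : {q : MvPolynomial (Fin 2) ℂ // pev q 0 = 1}) =>
    exists_mul_re_half_le (p n) q (hp n) q.2
  obtain ⟨q, hq0, hq⟩ : ∃ q : ℕ → {q : MvPolynomial (Fin 2) ℂ // pev q 0 = 1},
      q 0 = ⟨p 0, hp 0⟩ ∧ ∀ n, (q (n + 1) : MvPolynomial (Fin 2) ℂ) = f (n + 1) (q n) :=
    ⟨fun n => Nat.rec ⟨p 0, hp 0⟩ (fun n q => ⟨f (n + 1) q, hf0 (n + 1) q⟩) n, rfl, fun _ => rfl⟩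
  refine ⟨fun n => q n, fun n => ?_, fun n => (q n).2, fun n => ?_⟩
  · cases n with
    | zero => simp only [hq0, dvd_refl]
    | succ n =>
      simp only [hq]
      exact hdvd (n + 1) (q n)
  · simp only [hq]
    exact hf (n + 1) (q n)

theorem zero_mem_polyHull_iInter {q : ℕ → MvPolynomial (Fin 2) ℂ} (hq : ∀ n, pev (q n) 0 = 1)
    (hdec : ∀ n, ∀ x ∈ bidisk, 1 / 2 ≤ (pev (q (n + 1)) x).re → 1 / 2 ≤ (pev (q n) x).re) :
    (0 : ℂ × ℂ) ∈ polyHull {x ∈ frontier bidisk | ∀ n, 1 / 2 ≤ (pev (q n) x).re} := by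
  intro P M hPM
  set t : ℕ → Set (ℂ × ℂ) := fun n =>
    Metric.sphere 0 1 ∩ {x | 1 / 2 ≤ (pev (q n) x).re ∧ ‖pev P 0‖ ≤ ‖pev P x‖} with ht
  have hclosed : ∀ n, IsClosed {x | 1 / 2 ≤ (pev (q n) x).re ∧ ‖pev P 0‖ ≤ ‖pev P x‖} := fun n =>
    (isClosed_le continuous_const (Complex.continuous_re.comp (continuous_pev _))).inter
      (isClosed_le continuous_const (continuous_pev P).norm)
  obtain ⟨x, hx⟩ := IsCompact.nonempty_iInter_of_sequence_nonempty_isCompact_isClosed t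
    (by
      rintro n x ⟨hx, h1, h2⟩
      refine ⟨hx, hdec n x ?_ h1, h2⟩
      rw [bidisk_eq_closedBall]
      exact Metric.sphere_subset_closedBall hx)
    (by
      intro n
      obtain ⟨x, hx, hx0, hxP⟩ := exists_sphere_zero_norm_le (q := q n - 1) P (by
        have := hq n
        simp only [pev, map_sub, map_one] at *
        rw [this, sub_self])
      refine ⟨x, hx, ?_, hxP⟩
      have : pev (q n) x = 1 := by
        simp only [pev, map_sub, map_one] at *
        exact sub_eq_zero.1 hx0
      rw [this]
      norm_num)
    ((isCompact_sphere _ _).inter_right (hclosed 0))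
    fun n => Metric.isClosed_sphere.inter (hclosed n)
  rw [Set.mem_iInter] at hx
  refine (hx 0).2.2.trans (hPM x ⟨?_, fun n => (hx n).2.1⟩)
  rw [frontier_bidisk]
  exact (hx 0).1

theorem dense_isUnit_PY {Y : Set (ℂ × ℂ)} (hY : Y ⊆ bidisk) {p : ℕ → MvPolynomial (Fin 2) ℂ}
    (hdense : ∀ (Q : MvPolynomial (Fin 2) ℂ) (ε : ℝ), 0 < ε → ∃ n, ∃ a : ℂ, a ≠ 0 ∧
      ∀ x ∈ bidisk, ‖a * pev (p n) x - pev Q x‖ ≤ ε)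
    (hunit : ∀ n, IsUnit (polyRestrict hY (p n))) : Dense {f : PY Y | IsUnit f} := by
  intro f
  refine Metric.mem_closure_iff.2 fun ε hε => ?_
  have hf : (f : Y →ᵇ ℂ) ∈ closure (polySub Y : Set (Y →ᵇ ℂ)) := f.2
  obtain ⟨g, ⟨Q, hQ⟩, hg⟩ := Metric.mem_closure_iff.1 hf (ε / 2) (half_pos hε)
  obtain ⟨n, a, ha, hn⟩ := hdense Q (ε / 3) (by positivity)
  refine ⟨a • polyRestrict hY (p n), ?_, ?_⟩
  · have := (hunit n).smul (Units.mk0 a ha)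
    rwa [← Units.smul_mk0 ha]
  · have h2 : dist g ((a • polyRestrict hY (p n) : PY Y) : Y →ᵇ ℂ) ≤ ε / 3 := by
      refine (BoundedContinuousFunction.dist_le (by positivity)).2 fun y => ?_
      rw [dist_comm, dist_eq_norm, hQ y]
      exact hn y (hY y.2)
    have h3 := dist_triangle (f : Y →ᵇ ℂ) g ((a • polyRestrict hY (p n) : PY Y) : Y →ᵇ ℂ)
    rw [Subtype.dist_eq]
    linarith

/-- There exists a nonempty compact set `Y` contained in the topological boundary of the
closed unit bidisk in `ℂ²` such that `(0,0)` lies in the polynomial hull of `Y`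
(in particular `(0,0) ∉ Y`), and the uniform algebra `P(Y)` has dense invertibles. -/
theorem stmt0 :
    ∃ Y : Set (ℂ × ℂ), Y.Nonempty ∧ IsCompact Y ∧ Y ⊆ frontier bidisk ∧
      ((0 : ℂ), (0 : ℂ)) ∈ polyHull Y ∧ ((0 : ℂ), (0 : ℂ)) ∉ Y ∧
      Dense {f : PY Y | IsUnit f} := by
  obtain ⟨p, hp, hdense⟩ := exists_dense_seq
  obtain ⟨q, hpq, hq, hdec⟩ := exists_decreasing_seq p hp
  set Y : Set (ℂ × ℂ) := {x ∈ frontier bidisk | ∀ n, 1 / 2 ≤ (pev (q n) x).re} with hYdef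
  have hYs : Y ⊆ Metric.sphere 0 1 := fun x hx => by
    rw [← frontier_bidisk]
    exact hx.1
  have hYb : Y ⊆ bidisk := by
    rw [bidisk_eq_closedBall]
    exact hYs.trans Metric.sphere_subset_closedBall
  have hhull : (0 : ℂ × ℂ) ∈ polyHull Y := zero_mem_polyHull_iInter hq hdec
  have hclosed : IsClosed Y := by
    refine isClosed_frontier.inter ?_
    change IsClosed {x | ∀ n, 1 / 2 ≤ (pev (q n) x).re}
    simp only [Set.ofPred_forall]
    exact isClosed_iInter fun n =>
      isClosed_le continuous_const (Complex.continuous_re.comp (continuous_pev _))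
  refine ⟨Y, ?_, (isCompact_sphere (0 : ℂ × ℂ) 1).of_isClosed_subset hclosed hYs,
    fun x hx => hx.1, hhull, fun h0 => by simpa using hYs h0, ?_⟩
  · by_contra hne
    have := hhull 1 0 fun y hy => absurd ⟨y, hy⟩ hne
    simp [pev] at this
    linarith
  · refine dense_isUnit_PY hYb hdense fun n => ?_
    obtain ⟨r, hr⟩ := hpq n
    have hu := isUnit_polyRestrict_of_re hYb (q := q n) fun y hy => hy.2 n
    rw [hr, polyRestrict_mul] at hu
    exact isUnit_of_mul_isUnit_left hu
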